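/- Let q ≥ 2, let F_2 = ⟨a,b⟩ be the free group on two generators, and let N be the normal closure of a⁻¹bab^{−q} in F_2 (so F_2/N = BS(1,q)). For ℓ ≥ 2, let Γ_ℓ(N) = F_2/N^{(ℓ)} where N^{(1)} = N and N^{(j)} = [N^{(j−1)}, N^{(j−1)}], and let μ_ℓ be the lazy simple random walk measure on Γ_ℓ(N). Then there exists C < ∞ such that for all sufficiently large n: μ_ℓ^{(2n)}(e) ≥ exp(−C·n/(log_{[ℓ−1]} n)^2). -/

import Mathlib

open scoped Pointwise

noncomputable section

open Classical in
/-- Convolution of two real-valued functions ("measures") on a group: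
`(μ ∗ ν)(g) = Σ_h μ(h) ν(h⁻¹ g)`. -/
noncomputable def conv {G : Type*} [Group G] (μ ν : G → ℝ) : G → ℝ :=
  fun g => ∑' h : G, μ h * ν (h⁻¹ * g)

open Classical in
/-- `convPow μ n` is the `n`-fold convolution power of `μ`;
`convPow μ 0` is the Dirac mass at the identity. -/
noncomputable def convPow {G : Type*} [Group G] (μ : G → ℝ) : ℕ → G → ℝ
  | 0 => fun g => if g = 1 then 1 else 0
  | n + 1 => conv μ (convPow μ n)

/-- Pushforward of a measure along a map. -/
noncomputable def pushforward {G H : Type*} (f : G → H) (μ : G → ℝ) : H → ℝ :=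
  fun h => ∑' g : {g : G // f g = h}, μ g.1

open Classical in
/-- The lazy simple random walk measure on the free group on `r` generators:
mass `1/2` at the identity and mass `1/(4r)` at each `sᵢ^{±1}`. -/
noncomputable def lazySRW (r : ℕ) : FreeGroup (Fin r) → ℝ := fun g =>
  if g = 1 then 1 / 2
  else if ∃ i : Fin r, g = FreeGroup.of i ∨ g = (FreeGroup.of i)⁻¹ then 1 / (4 * r)
  else 0

/-- The lazy simple random walk measure on the quotient `F_r / M`, i.e. the pushforward
of `lazySRW r` under the quotient map. -/
noncomputable def lazySRWQuot (r : ℕ) (M : Subgroup (FreeGroup (Fin r))) [M.Normal] :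
    FreeGroup (Fin r) ⧸ M → ℝ :=
  pushforward (QuotientGroup.mk : FreeGroup (Fin r) → FreeGroup (Fin r) ⧸ M) (lazySRW r)

/-- Iterated logarithms: `iterLog 1 x = log (1 + x)` and
`iterLog (i+1) x = log (1 + iterLog i x)`. -/
noncomputable def iterLog : ℕ → ℝ → ℝ
  | 0, x => x
  | n + 1, x => Real.log (1 + iterLog n x)

instance derivedSeriesNormal (G : Type*) [Group G] (n : ℕ) : (derivedSeries G n).Normal :=
  derivedSeries_normal G n

/-- Iterated commutator subgroups: `iterComm N 0 = N` is `N^{(1)}` and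
`iterComm N j` is `N^{(j+1)} = [N^{(j)}, N^{(j)}]`. -/
def iterComm {G : Type*} [Group G] (N : Subgroup G) : ℕ → Subgroup G
  | 0 => N
  | j + 1 => ⁅iterComm N j, iterComm N j⁆

instance iterComm_normal {G : Type*} [Group G] (N : Subgroup G) [hN : N.Normal] (j : ℕ) :
    (iterComm N j).Normal := by
  induction j with
  | zero => exact hN
  | succ j ih => exact @Subgroup.commutator_normal G _ (iterComm N j) (iterComm N j) ih ih

/-! ### Actions of the free group -/

/-- Every word with a fixed point lies in `M`. -/
def StabIn {S : Type} (A : Fin 2 → Equiv.Perm S) (M : Subgroup (FreeGroup (Fin 2))) : Prop :=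
  ∀ (w : FreeGroup (Fin 2)) (s : S), FreeGroup.lift A w s = s → w ∈ M

/-- The extended action recording the flow. -/
def flowPerm {S : Type} (A : Fin 2 → Equiv.Perm S) (i : Fin 2) :
    Equiv.Perm (((S × Fin 2) →₀ ℤ) × S) where
  toFun p := (p.1 + Finsupp.single (p.2, i) 1, A i p.2)
  invFun p := (p.1 - Finsupp.single ((A i).symm p.2, i) 1, (A i).symm p.2)
  left_inv p := by ext <;> simp
  right_inv p := by ext <;> simp

lemma flowPerm_snd {S : Type} (A : Fin 2 → Equiv.Perm S) (w : FreeGroup (Fin 2))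
    (p : ((S × Fin 2) →₀ ℤ) × S) :
    (FreeGroup.lift (flowPerm A) w p).2 = FreeGroup.lift A w p.2 := by
  induction w using FreeGroup.induction_on generalizing p with
  | C1 => simp
  | of i => simp [flowPerm]
  | inv_of i _ => 
    simp only [map_inv, FreeGroup.lift_apply_of]
    rfl
  | mul x y hx hy => simp [hx, hy]

lemma stabIn_flow {S : Type} (A : Fin 2 → Equiv.Perm S) (M : Subgroup (FreeGroup (Fin 2)))
    [hM : M.Normal] (h : StabIn A M) : StabIn (flowPerm A) ⁅M, M⁆ := by
  classical
  let st : Setoid S :=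
    { r := fun y z => ∃ w, FreeGroup.lift A w y = z
      iseqv := ⟨fun y => ⟨1, by simp⟩, fun {y z} ⟨w, hw⟩ => ⟨w⁻¹, by
          rw [← hw, map_inv]; simp⟩,
        fun {x y z} ⟨w, hw⟩ ⟨v, hv⟩ => ⟨v * w, by rw [map_mul, Equiv.Perm.mul_apply, hw, hv]⟩⟩ }
  let rep : S → S := fun y => (Quotient.mk st y).out
  have hrep : ∀ w y, rep (FreeGroup.lift A w y) = rep y := by
    intro w y
    have : Quotient.mk st (FreeGroup.lift A w y) = Quotient.mk st y :=
      Quotient.sound (st.symm ⟨w, rfl⟩)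
    simp only [rep, this]
  have hex : ∀ y, ∃ w, FreeGroup.lift A w (rep y) = y := fun y => Quotient.mk_out (s := st) y
  choose σ hσ using hex
  have hmem : ∀ w y, (σ (FreeGroup.lift A w y))⁻¹ * w * σ y ∈ M := by
    intro w y
    apply h _ (rep y)
    rw [map_mul, map_mul, Equiv.Perm.mul_apply, Equiv.Perm.mul_apply, hσ, map_inv,
      Equiv.Perm.inv_eq_iff_eq]
    have := hσ (FreeGroup.lift A w y)
    rw [hrep] at this
    exact this.symm
  let κ : FreeGroup (Fin 2) → S → M := fun w y => ⟨_, hmem w y⟩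
  have κmul : ∀ w v y, κ (w * v) y = κ w (FreeGroup.lift A v y) * κ v y := by
    intro w v y
    apply Subtype.ext
    simp only [κ, map_mul, Equiv.Perm.mul_apply, Subgroup.coe_mul]
    group
  have κone : ∀ y, κ 1 y = 1 := by
    intro y; apply Subtype.ext; simp [κ]
  let cls : M → Additive (Abelianization M) := fun m => Additive.ofMul (Abelianization.of m)
  have clsmul : ∀ x y, cls (x * y) = cls x + cls y := by
    intro x y; simp [cls]
  have clsone : cls 1 = 0 := by simp [cls]
  let ψ : ((S × Fin 2) →₀ ℤ) →+ Additive (Abelianization M) :=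
    Finsupp.liftAddHom (fun e => (zmultiplesHom _) (cls (κ (FreeGroup.of e.2) e.1)))
  have ψs : ∀ y i, ψ (Finsupp.single (y, i) 1) = cls (κ (FreeGroup.of i) y) := by
    intro y i
    simp [ψ]
  have key : ∀ (w : FreeGroup (Fin 2)) (p : ((S × Fin 2) →₀ ℤ) × S),
      ψ (FreeGroup.lift (flowPerm A) w p).1 = ψ p.1 + cls (κ w p.2) := by
    intro w
    induction w using FreeGroup.induction_on with
    | C1 => intro p; simp [κone, clsone]
    | of i =>
      intro p
      simp [flowPerm, ψs]
    | inv_of i _ =>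
      intro p
      have e1 : (FreeGroup.lift (flowPerm A) (FreeGroup.of i)⁻¹ p).1
        = p.1 - Finsupp.single ((A i).symm p.2, i) 1 := by
        simp only [map_inv, FreeGroup.lift_apply_of]
        rfl
      rw [e1, map_sub, ψs]
      have e2 := κmul (FreeGroup.of i) (FreeGroup.of i)⁻¹ p.2
      have e3 : FreeGroup.lift A (FreeGroup.of i)⁻¹ p.2 = (A i).symm p.2 := by
        simp only [map_inv, FreeGroup.lift_apply_of]
        rfl
      rw [mul_inv_cancel, κone, e3] at e2
      have e4 := congrArg cls e2
      rw [clsmul, clsone] at e4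
      rw [sub_eq_add_neg]
      congr 1
      exact neg_eq_of_add_eq_zero_right e4.symm
    | mul x y hx hy =>
      intro p
      rw [map_mul, Equiv.Perm.mul_apply, hx, hy, κmul, clsmul, flowPerm_snd]
      abel
  intro w p hp
  have h1 := key w p
  have h2 : FreeGroup.lift A w p.2 = p.2 := by rw [← flowPerm_snd, hp]
  rw [hp] at h1
  have h3 : cls (κ w p.2) = 0 := by simpa using h1
  have h4 : κ w p.2 ∈ commutator M := by
    rw [← Abelianization.ker_of]
    exact h3
  have h5 : (κ w p.2 : FreeGroup (Fin 2)) ∈ ⁅M, M⁆ := by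
    rw [← Subgroup.map_subtype_commutator]
    exact ⟨_, h4, rfl⟩
  have h6 : (σ p.2)⁻¹ * w * σ p.2 ∈ ⁅M, M⁆ := by
    have : (κ w p.2 : FreeGroup (Fin 2)) = (σ p.2)⁻¹ * w * σ p.2 := by
      simp only [κ, h2]
    rwa [this] at h5
  have h7 := (Subgroup.commutator_normal M M).conj_mem _ h6 (σ p.2)
  have : σ p.2 * ((σ p.2)⁻¹ * w * σ p.2) * (σ p.2)⁻¹ = w := by group
  rwa [this] at h7

/-- Existence of an action with stabilizers in `M` and a finitely supported function with small
energy. -/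
def Fol (M : Subgroup (FreeGroup (Fin 2))) (ε : ℝ) (V : ℕ) : Prop :=
  ∃ (S : Type) (A : Fin 2 → Equiv.Perm S) (U : Finset S) (f : S → ℝ),
    StabIn A M ∧ (∀ s, 0 ≤ f s) ∧ U.card ≤ V ∧ (∀ s, s ∉ U → f s = 0) ∧ 0 < ∑ s ∈ U, f s ^ 2 ∧
    ∀ i, (1 - ε) * ∑ s ∈ U, f s ^ 2 ≤ ∑ s ∈ U, f s * f (A i s)

lemma card_shift {T : Type} [DecidableEq T] (E : Finset T) (L : ℕ) (e : T) (he : e ∈ E) :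
    ((L : ℝ) - 1) * ((E.finsupp (fun _ => Finset.Ico (0 : ℤ) L)).card : ℝ) ≤
    L * (((E.finsupp (fun _ => Finset.Ico (0 : ℤ) L)).filter (fun φ =>
      φ + Finsupp.single e 1 ∈ E.finsupp (fun _ => Finset.Ico (0 : ℤ) L))).card : ℝ) := by
  rcases Nat.eq_zero_or_pos L with rfl | hL
  · simp
  have hsub : E.finsupp (fun e' => if e' = e then Finset.Ico (0 : ℤ) (L - 1 : ℕ) else
      Finset.Ico (0 : ℤ) L) ⊆ ((E.finsupp (fun _ => Finset.Ico (0 : ℤ) L)).filter (fun φ =>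
      φ + Finsupp.single e 1 ∈ E.finsupp (fun _ => Finset.Ico (0 : ℤ) L))) := by
    intro φ hφ
    rw [Finset.mem_finsupp_iff] at hφ
    rw [Finset.mem_filter, Finset.mem_finsupp_iff, Finset.mem_finsupp_iff]
    obtain ⟨h1, h2⟩ := hφ
    refine ⟨⟨h1, ?_⟩, ?_, ?_⟩
    · intro i hi
      have := h2 i hi
      split_ifs at this
      · rw [Finset.mem_Ico] at *; omega
      · exact this
    · refine Finsupp.support_add.trans (Finset.union_subset h1 ?_)
      exact Finsupp.support_single_subset.trans (by simpa using he)
    · intro i hi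
      have := h2 i hi
      by_cases hie : i = e
      · subst hie
        simp at this ⊢
        omega
      · rw [if_neg hie] at this
        rw [Finsupp.add_apply, Finsupp.single_eq_of_ne hie]
        simpa using this
  have hc := Finset.card_le_card hsub
  rw [Finset.card_finsupp] at hc
  rw [Finset.card_finsupp]
  rw [← Finset.mul_prod_erase _ _ he] at hc
  rw [← Finset.mul_prod_erase _ _ he]
  have hp : ∏ x ∈ E.erase e, (if x = e then Finset.Ico (0 : ℤ) (L - 1 : ℕ) else
      Finset.Ico (0 : ℤ) L).card = ∏ x ∈ E.erase e, (Finset.Ico (0 : ℤ) L).card := by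
    apply Finset.prod_congr rfl
    intro x hx
    rw [if_neg (Finset.ne_of_mem_erase hx)]
  rw [hp] at hc
  simp only [if_true, Int.card_Ico, sub_zero, Int.toNat_natCast] at hc ⊢
  have hc' : (((L - 1 : ℕ) * ∏ x ∈ E.erase e, L : ℕ) : ℝ) ≤ _ := Nat.cast_le.mpr hc
  have hL1 : ((L - 1 : ℕ) : ℝ) = L - 1 := by rw [Nat.cast_sub hL]; simp
  push_cast at hc' ⊢
  rw [hL1] at hc'
  nlinarith [mul_le_mul_of_nonneg_left hc' (Nat.cast_nonneg (α := ℝ) L)]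

lemma Fol_step (M : Subgroup (FreeGroup (Fin 2))) [M.Normal] (ε : ℝ) (hε : 0 ≤ ε) (V L : ℕ)
    (hL : 1 ≤ L) (h : Fol M ε V) : Fol ⁅M, M⁆ (ε + 1 / L) (V * L ^ (2 * V)) := by
  classical
  obtain ⟨S, A, U, f, hst, hf0, hU, hf, hpos, hcor⟩ := h
  set E : Finset (S × Fin 2) := U ×ˢ Finset.univ with hE
  set B := E.finsupp (fun _ => Finset.Ico (0 : ℤ) L) with hB
  have hEc : E.card = 2 * U.card := by
    rw [hE, Finset.card_product]; simp [mul_comm]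
  have hBc : B.card = L ^ (2 * U.card) := by
    rw [hB, Finset.card_finsupp]; simp [hEc]
  have hLpos : (0 : ℝ) < L := by exact_mod_cast hL
  have hBpos : (0 : ℝ) < B.card := by rw [hBc]; positivity
  refine ⟨_, flowPerm A, B ×ˢ U, fun p => if p.1 ∈ B then f p.2 else 0, stabIn_flow A M hst,
    ?_, ?_, ?_, ?_, ?_⟩
  · intro p
    dsimp only
    split_ifs
    · exact hf0 _
    · exact le_rfl
  · rw [Finset.card_product, hBc, mul_comm]
    exact Nat.mul_le_mul hU (Nat.pow_le_pow_right hL (by omega))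
  · rintro ⟨φ, x⟩ hx
    simp only [Finset.mem_product, not_and_or] at hx
    rcases hx with hx | hx
    · simp [hx]
    · simp [hf x hx]
  all_goals
    have hn : ∑ s ∈ B ×ˢ U, (if s.1 ∈ B then f s.2 else 0) ^ 2 = B.card * ∑ s ∈ U, f s ^ 2 := by
      rw [Finset.sum_product]
      rw [Finset.sum_congr rfl (g := fun _ => ∑ s ∈ U, f s ^ 2)]
      · simp
      · intro φ hφ
        simp [hφ]
  · rw [hn]; positivity
  · intro i
    rw [hn]
    have hc : ∑ s ∈ B ×ˢ U, (if s.1 ∈ B then f s.2 else 0) *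
        (if (flowPerm A i s).1 ∈ B then f (flowPerm A i s).2 else 0) =
        ∑ x ∈ U, (f x * f (A i x)) *
          ((B.filter (fun φ => φ + Finsupp.single (x, i) 1 ∈ B)).card : ℝ) := by
      rw [Finset.sum_product_right]
      apply Finset.sum_congr rfl
      intro x hx
      rw [Finset.card_filter, Nat.cast_sum, Finset.mul_sum]
      apply Finset.sum_congr rfl
      intro φ hφ
      by_cases hm : φ + Finsupp.single (x, i) 1 ∈ B
      · simp [hφ, flowPerm, hm]
      · simp [hφ, flowPerm, hm]
    rw [hc]
    have hterm : ∀ x ∈ U, (f x * f (A i x)) * ((1 - 1 / L) * B.card) ≤ (f x * f (A i x)) *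
          ((B.filter (fun φ => φ + Finsupp.single (x, i) 1 ∈ B)).card : ℝ) := by
      intro x hx
      apply mul_le_mul_of_nonneg_left _ (mul_nonneg (hf0 _) (hf0 _))
      have := card_shift E L (x, i) (by simp [hE, hx])
      rw [← hB] at this
      have h2 : (1 - 1 / (L : ℝ)) * B.card = ((L - 1) * B.card) / L := by field_simp
      rw [h2, div_le_iff₀ hLpos, mul_comm _ (L : ℝ)]
      exact this
    refine le_trans ?_ (Finset.sum_le_sum hterm)
    rw [← Finset.sum_mul]
    have hL1 : 0 ≤ 1 - 1 / (L : ℝ) := by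
      rw [sub_nonneg, div_le_one hLpos]; exact_mod_cast hL
    have h3 := mul_le_mul_of_nonneg_right (hcor i) (mul_nonneg hL1 hBpos.le)
    refine le_trans ?_ h3
    have h4 : 0 ≤ ε * (1 / (L : ℝ)) * (B.card * ∑ s ∈ U, f s ^ 2) := by positivity
    nlinarith [h4]

/-! ### The base case: the Baumslag–Solitar group -/

/-- Action of the Baumslag–Solitar group. -/
def bsPerm (q : ℕ) (i : Fin 2) : Equiv.Perm (ℚ × ℤ) :=
  if i = 0 then
    { toFun := fun p => (p.1, p.2 + 1)
      invFun := fun p => (p.1, p.2 - 1)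
      left_inv := fun p => by simp
      right_inv := fun p => by simp }
  else
    { toFun := fun p => (p.1 + (q : ℚ) ^ p.2, p.2)
      invFun := fun p => (p.1 - (q : ℚ) ^ p.2, p.2)
      left_inv := fun p => by simp
      right_inv := fun p => by simp }

lemma bsPerm_zero_zpow (q : ℕ) (k : ℤ) (p : ℚ × ℤ) :
    ((bsPerm q 0) ^ k) p = (p.1, p.2 + k) := by
  induction k using Int.induction_on generalizing p with
  | zero => simp
  | succ n ih => rw [zpow_add_one, Equiv.Perm.mul_apply, ih]; simp [bsPerm]; ring
  | pred n ih =>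
    rw [zpow_sub_one, Equiv.Perm.mul_apply, ih]
    have : (bsPerm q 0)⁻¹ p = (p.1, p.2 - 1) := by
      rw [Equiv.Perm.inv_eq_iff_eq]; simp [bsPerm]
    rw [this]; ext <;> simp; ring

lemma bsPerm_one_zpow (q : ℕ) (k : ℤ) (p : ℚ × ℤ) :
    ((bsPerm q 1) ^ k) p = (p.1 + k * (q : ℚ) ^ p.2, p.2) := by
  induction k using Int.induction_on generalizing p with
  | zero => simp
  | succ n ih => rw [zpow_add_one, Equiv.Perm.mul_apply, ih]; simp [bsPerm]; ring
  | pred n ih =>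
    rw [zpow_sub_one, Equiv.Perm.mul_apply, ih]
    have : (bsPerm q 1)⁻¹ p = (p.1 - (q : ℚ) ^ p.2, p.2) := by
      rw [Equiv.Perm.inv_eq_iff_eq]; simp [bsPerm]
    rw [this]; ext <;> simp; ring

lemma bs_stabIn (q : ℕ) (hq : 2 ≤ q) (N : Subgroup (FreeGroup (Fin 2)))
    (hN : N = Subgroup.normalClosure
      {(FreeGroup.of 0)⁻¹ * FreeGroup.of 1 * FreeGroup.of 0 * (FreeGroup.of 1) ^ (-(q : ℤ))}) :
    StabIn (bsPerm q) N := by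
  have hNn : N.Normal := by rw [hN]; infer_instance
  set a : FreeGroup (Fin 2) := FreeGroup.of 0 with ha
  set b : FreeGroup (Fin 2) := FreeGroup.of 1 with hb
  let π := QuotientGroup.mk' N
  have hrel : (π a)⁻¹ * π b * π a = (π b) ^ (q : ℤ) := by
    have : a⁻¹ * b * a * b ^ (-(q : ℤ)) ∈ N := by
      rw [hN]; exact Subgroup.subset_normalClosure rfl
    have h2 : π (a⁻¹ * b * a * b ^ (-(q : ℤ))) = 1 := (QuotientGroup.eq_one_iff _).2 this
    simp only [map_mul, map_inv, map_zpow, zpow_neg] at h2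
    exact mul_inv_eq_one.mp h2
  have hcomm : ∀ k : ℤ, (π a)⁻¹ * (π b) ^ k = (π b) ^ (q * k) * (π a)⁻¹ := by
    intro k
    rw [zpow_mul, ← hrel]
    have : ((π a)⁻¹ * π b * π a) ^ k = (π a)⁻¹ * (π b) ^ k * π a := by
      have := conj_zpow (a := (π a)⁻¹) (b := π b) (i := k)
      simpa using this
    rw [this]; group
  have hcomm2 : ∀ (i : ℕ) (k : ℤ), (π b) ^ k * (π a) ^ i = (π a) ^ i * (π b) ^ (q ^ i * k) := by
    intro i
    induction i with
    | zero => simp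
    | succ i ih =>
      intro k
      have h3 : ∀ k : ℤ, (π b) ^ k * π a = π a * (π b) ^ (q * k) := by
        intro k
        have := hcomm k
        rw [inv_mul_eq_iff_eq_mul, ← mul_assoc, eq_mul_inv_iff_mul_eq] at this
        exact this
      rw [pow_succ, ← mul_assoc, ih, mul_assoc, h3, ← mul_assoc]
      congr 2
      ring
  have nf : ∀ w : FreeGroup (Fin 2), ∀ (i j : ℕ) (k : ℤ), ∃ (i' j' : ℕ) (k' : ℤ),
      π w * ((π a) ^ i * (π b) ^ k * ((π a)⁻¹) ^ j) =
        (π a) ^ i' * (π b) ^ k' * ((π a)⁻¹) ^ j' := by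
    intro w
    induction w using FreeGroup.induction_on with
    | C1 => intro i j k; exact ⟨i, j, k, by simp⟩
    | of x =>
      intro i j k
      fin_cases x
      · refine ⟨i + 1, j, k, ?_⟩
        simp only [pow_succ', mul_assoc]; rfl
      · refine ⟨i, j, q ^ i * 1 + k, ?_⟩
        rw [zpow_add, ← mul_assoc (π a ^ i), ← hcomm2, zpow_one]
        simp only [mul_assoc]; rfl
    | inv_of x _ =>
      intro i j k
      fin_cases x
      · change ∃ (i' j' : ℕ) (k' : ℤ), π (a⁻¹) * _ = _
        rw [map_inv]
        cases i with
        | zero =>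
          refine ⟨0, j + 1, q * k, ?_⟩
          rw [pow_zero, one_mul, one_mul, ← mul_assoc, hcomm, pow_succ', mul_assoc]
        | succ i =>
          refine ⟨i, j, k, ?_⟩
          rw [pow_succ']; group
      · refine ⟨i, j, q ^ i * (-1) + k, ?_⟩
        rw [zpow_add, ← mul_assoc (π a ^ i), ← hcomm2, zpow_neg_one]
        simp only [mul_assoc, map_inv]; rfl
    | mul x y hx hy =>
      intro i j k
      obtain ⟨i', j', k', h'⟩ := hy i j k
      obtain ⟨i2, j2, k2, h2⟩ := hx i' j' k'
      exact ⟨i2, j2, k2, by rw [map_mul, mul_assoc, h', h2]⟩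
  have htriv : ∀ w ∈ N, FreeGroup.lift (bsPerm q) w = 1 := by
    have : N ≤ (FreeGroup.lift (bsPerm q)).ker := by
      rw [hN]
      apply Subgroup.normalClosure_le_normal
      rw [Set.singleton_subset_iff]
      change FreeGroup.lift (bsPerm q) _ = 1
      rw [map_mul, map_zpow, zpow_neg, mul_inv_eq_one]
      simp only [map_mul, map_inv, ha, hb, FreeGroup.lift_apply_of]
      ext1 p
      rw [bsPerm_one_zpow, Equiv.Perm.mul_apply, Equiv.Perm.mul_apply, Equiv.Perm.inv_eq_iff_eq]
      have : (q : ℚ) ≠ 0 := by positivity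
      simp [bsPerm, zpow_add_one₀ this, mul_comm]
    exact this
  intro w s hw
  obtain ⟨i, j, k, h⟩ := nf w 0 0 0
  have h' : π w = π (a ^ i * b ^ k * (a⁻¹) ^ j) := by simpa using h
  have hmem : (a ^ i * b ^ k * (a⁻¹) ^ j)⁻¹ * w ∈ N := QuotientGroup.eq.1 h'.symm
  have h3 := htriv _ hmem
  rw [map_mul, map_inv, inv_mul_eq_one] at h3
  rw [← h3] at hw
  simp only [map_mul, map_inv, map_pow, map_zpow, ha, hb, FreeGroup.lift_apply_of, inv_pow,
    Equiv.Perm.mul_apply] at hw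
  rw [← zpow_natCast, ← zpow_natCast, ← zpow_neg, bsPerm_zero_zpow, bsPerm_one_zpow,
    bsPerm_zero_zpow, Prod.ext_iff] at hw
  obtain ⟨e1, e2⟩ := hw
  simp only at e1 e2
  have hij : i = j := by omega
  have hk : k = 0 := by
    have hq0 : (q : ℚ) ≠ 0 := by positivity
    have : (k : ℚ) * (q : ℚ) ^ (s.2 + -(j : ℤ)) = 0 := by linarith
    rcases mul_eq_zero.1 this with h | h
    · exact_mod_cast h
    · exact absurd h (zpow_ne_zero _ hq0)
  subst hij hk
  rw [← QuotientGroup.eq_one_iff]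
  change π w = 1
  rw [h']
  simp

lemma sum_sq_aux (R : ℝ) (n : ℕ) : ∑ m ∈ Finset.range n, ((m : ℝ) * (R - m)) ^ 2 =
    R ^ 2 * ((n - 1) * n * (2 * n - 1) / 6) - 2 * R * ((n - 1) * n / 2) ^ 2 +
    ((n - 1) * n * (2 * n - 1) * (3 * (n - 1) ^ 2 + 3 * (n - 1) - 1) / 30) := by
  induction n with
  | zero => simp
  | succ n ih => rw [Finset.sum_range_succ, ih]; push_cast; ring

lemma sum_sq_diff_aux (R : ℝ) (n : ℕ) : ∑ m ∈ Finset.range n, (R - 1 - 2 * (m : ℝ)) ^ 2 =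
    n * (R - 1) ^ 2 - 4 * (R - 1) * ((n - 1) * n / 2) + 4 * ((n - 1) * n * (2 * n - 1) / 6) := by
  induction n with
  | zero => simp
  | succ n ih => rw [Finset.sum_range_succ, ih]; push_cast; ring

lemma sum_shift_aux (R : ℝ) (n : ℕ) :
    ∑ m ∈ Finset.range n, ((m : ℝ) * (R - m)) * (((m : ℝ) + 1) * (R - (m + 1))) =
    ∑ m ∈ Finset.range n, ((m : ℝ) * (R - m)) ^ 2
      - (1 / 2) * ∑ m ∈ Finset.range n, (R - 1 - 2 * (m : ℝ)) ^ 2 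
      + (1 / 2) * (n * (R - n)) ^ 2 := by
  induction n with
  | zero => simp
  | succ n ih => 
    rw [Finset.sum_range_succ, ih, Finset.sum_range_succ, Finset.sum_range_succ]; push_cast; ring

lemma Fol_base (q : ℕ) (hq : 2 ≤ q) (N : Subgroup (FreeGroup (Fin 2)))
    (hN : N = Subgroup.normalClosure
      {(FreeGroup.of 0)⁻¹ * FreeGroup.of 1 * FreeGroup.of 0 * (FreeGroup.of 1) ^ (-(q : ℤ))})
    (r : ℕ) (hr : 2 ≤ r) : Fol N (5 / (r : ℝ) ^ 2) (r ^ 3 * q ^ r) := by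
  classical
  set K : ℕ := q ^ r * r ^ 2 with hK
  set U : Finset (ℚ × ℤ) := ((Finset.range K).image (fun j : ℕ => (j : ℚ))) ×ˢ
    ((Finset.range r).image (fun j : ℕ => (j : ℤ))) with hU
  have hsum : ∀ F : ℚ × ℤ → ℝ, ∑ s ∈ U, F s =
      ∑ m ∈ Finset.range r, ∑ j ∈ Finset.range K, F ((j : ℚ), (m : ℤ)) := by
    intro F
    rw [hU, Finset.sum_product_right, Finset.sum_image (by intro x _ y _ h; simpa using h)]
    apply Finset.sum_congr rfl
    intro m _
    rw [Finset.sum_image (by intro x _ y _ h; simpa using h)]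
  have hmemU : ∀ j m : ℕ, ((j : ℚ), (m : ℤ)) ∈ U ↔ j < K ∧ m < r := by
    intro j m
    simp [hU]
  let f : ℚ × ℤ → ℝ := fun s => if s ∈ U then (s.2 : ℝ) * (r - s.2) else 0
  have hfv : ∀ j m : ℕ, j < K → m < r → f ((j : ℚ), (m : ℤ)) = (m : ℝ) * (r - m) := by
    intro j m hj hm
    simp only [f, if_pos ((hmemU j m).2 ⟨hj, hm⟩)]
    simp
  have hr0 : (0 : ℝ) < r := by positivity
  have hr2 : (2 : ℝ) ≤ r := by exact_mod_cast hr
  have hK0 : (0 : ℝ) < K := by rw [hK]; positivity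
  have hnorm : ∑ s ∈ U, f s ^ 2 = K * ∑ m ∈ Finset.range r, ((m : ℝ) * (r - m)) ^ 2 := by
    rw [hsum, Finset.mul_sum]
    apply Finset.sum_congr rfl
    intro m hm
    rw [Finset.sum_congr rfl (g := fun _ => ((m : ℝ) * (r - m)) ^ 2)]
    · simp
    · intro j hj
      rw [hfv j m (Finset.mem_range.1 hj) (Finset.mem_range.1 hm)]
  have hT : ∑ m ∈ Finset.range r, ((m : ℝ) * (r - m)) ^ 2 =
      (r : ℝ) * ((r : ℝ) ^ 2 - 1) * ((r : ℝ) ^ 2 + 1) / 30 := by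
    rw [sum_sq_aux]; ring
  have hTpos : 0 < ∑ m ∈ Finset.range r, ((m : ℝ) * (r - m)) ^ 2 := by
    rw [hT]
    have : 0 < (r : ℝ) ^ 2 - 1 := by nlinarith
    positivity
  refine ⟨_, bsPerm q, U, f, bs_stabIn q hq N hN, ?_, ?_, ?_, ?_, ?_⟩
  · intro s
    simp only [f]
    split_ifs with hs
    · simp only [hU, Finset.mem_product, Finset.mem_image, Finset.mem_range] at hs
      obtain ⟨_, m, hm, hm2⟩ := hs
      rw [← hm2]
      have : (m : ℝ) ≤ r := by exact_mod_cast hm.le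
      have h2 : 0 ≤ (r : ℝ) - m := by linarith
      simp only [Int.cast_natCast]
      positivity
    · exact le_rfl
  · rw [hU, Finset.card_product]
    refine (Nat.mul_le_mul Finset.card_image_le Finset.card_image_le).trans ?_
    rw [Finset.card_range, Finset.card_range, hK]
    apply le_of_eq; ring
  · intro s hs
    simp only [f, if_neg hs]
  · rw [hnorm]; positivity
  · intro i
    rw [hnorm]
    fin_cases i
    · have : ∑ s ∈ U, f s * f (bsPerm q 0 s) = K * ∑ m ∈ Finset.range r,
          ((m : ℝ) * (r - m)) * (((m : ℝ) + 1) * (r - (m + 1))) := by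
        rw [hsum, Finset.mul_sum]
        apply Finset.sum_congr rfl
        intro m hm
        rw [Finset.sum_congr rfl
          (g := fun _ => ((m : ℝ) * (r - m)) * (((m : ℝ) + 1) * (r - (m + 1))))]
        · simp
        · intro j hj
          rw [Finset.mem_range] at hj hm
          rw [hfv j m hj hm]
          congr 1
          have hb : bsPerm q 0 ((j : ℚ), (m : ℤ)) = ((j : ℚ), ((m + 1 : ℕ) : ℤ)) := by
            simp [bsPerm]
          rw [hb]
          rcases Nat.lt_or_ge (m + 1) r with h | h
          · rw [hfv j _ hj h]; push_cast; ring
          · have hrm : r = m + 1 := by omega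
            have : ((j : ℚ), ((m + 1 : ℕ) : ℤ)) ∉ U := by
              rw [hmemU]; omega
            simp only [f, if_neg this, hrm]
            push_cast; ring
      change _ ≤ ∑ s ∈ U, f s * f (bsPerm q 0 s)
      rw [this, sum_shift_aux, sum_sq_diff_aux, hT]
      rw [mul_left_comm]
      apply mul_le_mul_of_nonneg_left _ hK0.le
      have h5 : (1 - 5 / (r : ℝ) ^ 2) * ((r : ℝ) * ((r : ℝ) ^ 2 - 1) * ((r : ℝ) ^ 2 + 1) / 30) =
        (r : ℝ) * ((r : ℝ) ^ 2 - 1) * ((r : ℝ) ^ 2 + 1) / 30 - 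
          (r * ((r : ℝ) ^ 2 - 1) / 6 + ((r : ℝ) ^ 2 - 1) / (6 * r)) := by
        field_simp
        ring
      have h6 : 0 ≤ ((r : ℝ) ^ 2 - 1) / (6 * r) := by
        have : 0 < (r : ℝ) ^ 2 - 1 := by nlinarith
        positivity
      rw [h5]
      ring_nf at h6 ⊢
      linarith
    · change _ ≤ ∑ s ∈ U, f s * f (bsPerm q 1 s)
      rw [hsum, mul_left_comm, Finset.mul_sum, Finset.mul_sum]
      apply Finset.sum_le_sum
      intro m hm
      rw [Finset.mem_range] at hm
      have hqm : q ^ m ≤ q ^ r := Nat.pow_le_pow_right (by omega) hm.le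
      have hqr : q ^ r ≤ K := by
        rw [hK]; exact Nat.le_mul_of_pos_right _ (by positivity)
      have hle : ∑ j ∈ Finset.range (K - q ^ m), ((m : ℝ) * (r - m)) ^ 2 ≤
          ∑ j ∈ Finset.range K, f ((j : ℚ), (m : ℤ)) * f (bsPerm q 1 ((j : ℚ), (m : ℤ))) := by
        have hb : ∀ j : ℕ, bsPerm q 1 ((j : ℚ), (m : ℤ)) = (((j + q ^ m : ℕ) : ℚ), (m : ℤ)) := by
          intro j; simp [bsPerm]
        have hfn : ∀ j : ℕ, 0 ≤ f ((j : ℚ), (m : ℤ)) := by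
          intro j
          by_cases hj : j < K
          · rw [hfv j m hj hm]
            have : (m : ℝ) ≤ r := by exact_mod_cast hm.le
            have h2 : 0 ≤ (r : ℝ) - m := by linarith
            positivity
          · have : ((j : ℚ), (m : ℤ)) ∉ U := by
              rw [hmemU]; omega
            simp only [f, if_neg this, le_refl]
        have hsub : Finset.range (K - q ^ m) ⊆ Finset.range K :=
          Finset.range_subset_range.2 (Nat.sub_le _ _)
        refine le_trans (le_of_eq ?_) (Finset.sum_le_sum_of_subset_of_nonneg hsub ?_)
        · apply Finset.sum_congr rfl
          intro j hj
          rw [Finset.mem_range] at hj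
          rw [hb, hfv j m (by omega) hm, hfv _ m (by omega) hm]; ring
        · intro j _ _
          rw [hb]
          exact mul_nonneg (hfn _) (hfn _)
      refine le_trans ?_ hle
      rw [Finset.sum_const, Finset.card_range, nsmul_eq_mul, ← mul_assoc]
      apply mul_le_mul_of_nonneg_right _ (sq_nonneg _)
      rw [Nat.cast_sub (hqm.trans hqr)]
      have h1 : ((q ^ m : ℕ) : ℝ) ≤ (q ^ r : ℕ) := Nat.cast_le.2 hqm
      have h2 : (K : ℝ) * (5 / (r : ℝ) ^ 2) = 5 * (q ^ r : ℕ) := by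
        rw [hK]; push_cast; field_simp
      have h3 : (0 : ℝ) ≤ (q ^ r : ℕ) := Nat.cast_nonneg _
      rw [mul_sub, h2]
      linarith

/-! ### Return probability lower bound -/

/-- Inner product on finitely supported functions. -/
def ip {S : Type} (f g : S →₀ ℝ) : ℝ := f.sum fun s c => c * g s

lemma ip_eq {S : Type} [DecidableEq S] (f g : S →₀ ℝ) (U : Finset S) (hf : f.support ⊆ U) :
    ip f g = ∑ s ∈ U, f s * g s := by
  unfold ip
  rw [Finsupp.sum_of_support_subset _ hf]
  simp

lemma ip_comm {S : Type} (f g : S →₀ ℝ) : ip f g = ip g f := by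
  classical
  rw [ip_eq f g (f.support ∪ g.support) Finset.subset_union_left,
    ip_eq g f (f.support ∪ g.support) Finset.subset_union_right]
  simp only [mul_comm]

lemma ip_add_left {S : Type} (f g h : S →₀ ℝ) : ip (f + g) h = ip f h + ip g h := by
  classical
  unfold ip
  rw [Finsupp.sum_add_index'] <;> simp [add_mul]

lemma ip_smul_left {S : Type} (c : ℝ) (f h : S →₀ ℝ) : ip (c • f) h = c * ip f h := by
  classical
  unfold ip
  rw [Finsupp.sum_smul_index' (by simp), Finsupp.mul_sum]
  simp [mul_assoc]

lemma ip_add_right {S : Type} (f g h : S →₀ ℝ) : ip h (f + g) = ip h f + ip h g := by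
  rw [ip_comm, ip_add_left, ip_comm f, ip_comm g]

lemma ip_smul_right {S : Type} (c : ℝ) (f h : S →₀ ℝ) : ip h (c • f) = c * ip h f := by
  rw [ip_comm, ip_smul_left, ip_comm]

lemma ip_self_nonneg {S : Type} (f : S →₀ ℝ) : 0 ≤ ip f f :=
  Finset.sum_nonneg fun _ _ => mul_self_nonneg _

lemma ip_cs {S : Type} (f g : S →₀ ℝ) : ip f g ^ 2 ≤ ip f f * ip g g := by
  classical
  rw [ip_eq f g (f.support ∪ g.support) Finset.subset_union_left,
    ip_eq f f (f.support ∪ g.support) Finset.subset_union_left,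
    ip_eq g g (f.support ∪ g.support) Finset.subset_union_right]
  simp only [← sq]
  exact Finset.sum_mul_sq_le_sq_mul_sq _ _ _

lemma ip_perm {S : Type} (e : Equiv.Perm S) (f g : S →₀ ℝ) :
    ip (f.equivMapDomain e) g = ip f (g.equivMapDomain e.symm) := by
  unfold ip
  rw [Finsupp.sum_equivMapDomain]
  simp

/-- The Markov operator of the lazy walk. -/
def mark {S : Type} (A : Fin 2 → Equiv.Perm S) (f : S →₀ ℝ) : S →₀ ℝ :=
  (1 / 2 : ℝ) • f + ((1 / 8 : ℝ) • (f.equivMapDomain (A 0) + f.equivMapDomain (A 0).symm) +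
    (1 / 8 : ℝ) • (f.equivMapDomain (A 1) + f.equivMapDomain (A 1).symm))

lemma mark_apply {S : Type} (A : Fin 2 → Equiv.Perm S) (f : S →₀ ℝ) (s : S) :
    mark A f s = 1 / 2 * f s + (1 / 8 * (f ((A 0).symm s) + f (A 0 s)) +
      1 / 8 * (f ((A 1).symm s) + f (A 1 s))) := by
  simp [mark, Finsupp.equivMapDomain_apply]
  ring

lemma mark_symm {S : Type} (A : Fin 2 → Equiv.Perm S) (f g : S →₀ ℝ) :
    ip (mark A f) g = ip f (mark A g) := by
  simp only [mark, ip_add_left, ip_smul_left, ip_add_right, ip_smul_right, ip_perm,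
    Equiv.symm_symm]
  ring

lemma mark_iter_symm {S : Type} (A : Fin 2 → Equiv.Perm S) (n : ℕ) (f g : S →₀ ℝ) :
    ip ((mark A)^[n] f) g = ip f ((mark A)^[n] g) := by
  induction n generalizing f with
  | zero => simp
  | succ n ih =>
    rw [Function.iterate_succ_apply, ih, Function.iterate_succ_apply', mark_symm]

lemma ip_single {S : Type} (s : S) (g : S →₀ ℝ) : ip (Finsupp.single s 1) g = g s := by
  simp [ip]

lemma mark_iter_linear {S : Type} (A : Fin 2 → Equiv.Perm S) (n : ℕ) (f : S →₀ ℝ) (t : S) :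
    ((mark A)^[n] f) t = ∑ s ∈ f.support, f s * ((mark A)^[n] (Finsupp.single t 1)) s := by
  classical
  rw [← ip_single, ← mark_iter_symm, ip_comm, ip_eq _ _ _ subset_rfl]

lemma mark_diag {S : Type} (A : Fin 2 → Equiv.Perm S) (n : ℕ) (s t : S) (p : ℝ)
    (hp : ∀ s, ((mark A)^[2 * n] (Finsupp.single s 1)) s ≤ p) :
    |((mark A)^[2 * n] (Finsupp.single t 1)) s| ≤ p := by
  have h : ∀ s t, ((mark A)^[2 * n] (Finsupp.single t 1)) s =
      ip ((mark A)^[n] (Finsupp.single s 1)) ((mark A)^[n] (Finsupp.single t 1)) := by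
    intro s t
    rw [mark_iter_symm, ← Function.iterate_add_apply, ip_single, two_mul]
  have h1 := ip_cs ((mark A)^[n] (Finsupp.single s 1)) ((mark A)^[n] (Finsupp.single t 1))
  have h2 := hp s
  have h3 := hp t
  rw [h] at h2 h3 ⊢
  have h4 := ip_self_nonneg ((mark A)^[n] (Finsupp.single s (1 : ℝ)))
  have h5 := ip_self_nonneg ((mark A)^[n] (Finsupp.single t (1 : ℝ)))
  apply abs_le_of_sq_le_sq _ (h4.trans h2)
  refine h1.trans ?_
  rw [sq]
  exact mul_le_mul h2 h3 h5 (h4.trans h2)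

lemma mark_growth {S : Type} (A : Fin 2 → Equiv.Perm S) (f : S →₀ ℝ) (lam : ℝ) (hl : 0 ≤ lam)
    (hpos : 0 < ip f f) (hf : lam * ip f f ≤ ip (mark A f) f) (n : ℕ) :
    lam ^ (2 * n) * ip f f ≤ ip ((mark A)^[2 * n] f) f := by
  rcases hl.eq_or_lt with rfl | hl
  · rcases Nat.eq_zero_or_pos n with rfl | hn
    · simp
    · rw [zero_pow (by omega), zero_mul, two_mul, Function.iterate_add_apply, mark_iter_symm]
      exact ip_self_nonneg _
  set b : ℕ → ℝ := fun k => ip ((mark A)^[k] f) ((mark A)^[k] f) with hb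
  have hbn : ∀ k, 0 ≤ b k := fun k => ip_self_nonneg _
  have hb2 : ∀ k, b (k + 1) ^ 2 ≤ b k * b (k + 2) := by
    intro k
    have : b (k + 1) = ip ((mark A)^[k] f) ((mark A)^[k + 2] f) := by
      simp only [hb]
      rw [Function.iterate_succ_apply', mark_symm, ← Function.iterate_succ_apply' (mark A),
        ← Function.iterate_succ_apply' (mark A)]
    rw [this]
    exact ip_cs _ _
  have key : ∀ k, 0 < b k ∧ lam ^ 2 * b k ≤ b (k + 1) := by
    intro k
    induction k with
    | zero =>
      refine ⟨hpos, ?_⟩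
      have h1 := ip_cs (mark A f) f
      have h2 : (lam * ip f f) ^ 2 ≤ ip (mark A f) f ^ 2 :=
        pow_le_pow_left₀ (by positivity) hf 2
      change lam ^ 2 * ip f f ≤ ip (mark A f) (mark A f)
      have h3 : (lam ^ 2 * ip f f) * ip f f ≤ ip (mark A f) (mark A f) * ip f f := by
        nlinarith
      exact le_of_mul_le_mul_right h3 hpos
    | succ k ih =>
      obtain ⟨h1, h2⟩ := ih
      have h3 : 0 < b (k + 1) := lt_of_lt_of_le (by positivity) h2
      refine ⟨h3, ?_⟩
      have h4 := hb2 k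
      have h5 : (lam ^ 2 * b (k + 1)) * b k ≤ b (k + 2) * b k := by
        nlinarith
      exact le_of_mul_le_mul_right h5 h1
  have h6 : ∀ k, lam ^ (2 * k) * b 0 ≤ b k := by
    intro k
    induction k with
    | zero => simp
    | succ k ih =>
      refine le_trans ?_ (key k).2
      rw [mul_add, pow_add, mul_comm (lam ^ (2 * k)), mul_assoc]
      exact mul_le_mul_of_nonneg_left ih (by positivity)
  have := h6 n
  rw [two_mul n, Function.iterate_add_apply, mark_iter_symm, ← two_mul]
  exact this

lemma mark_upper {S : Type} (A : Fin 2 → Equiv.Perm S) (f : S →₀ ℝ) (n : ℕ) (p : ℝ)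
    (hp : ∀ s, ((mark A)^[2 * n] (Finsupp.single s 1)) s ≤ p) :
    ip ((mark A)^[2 * n] f) f ≤ p * (f.support.card * ip f f) := by
  classical
  rw [ip_comm, ip_eq _ _ _ subset_rfl, ip_eq f f _ subset_rfl]
  have h1 : ∀ t ∈ f.support, f t * ((mark A)^[2 * n] f) t ≤
      |f t| * ∑ s ∈ f.support, |f s| * p := by
    intro t _
    refine (le_abs_self _).trans ?_
    rw [abs_mul]
    apply mul_le_mul_of_nonneg_left _ (abs_nonneg _)
    rw [mark_iter_linear]
    refine (Finset.abs_sum_le_sum_abs _ _).trans (Finset.sum_le_sum ?_)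
    intro s _
    rw [abs_mul]
    exact mul_le_mul_of_nonneg_left (mark_diag A n s t p hp) (abs_nonneg _)
  refine (Finset.sum_le_sum h1).trans ?_
  rw [← Finset.sum_mul, ← Finset.sum_mul]
  rcases f.support.eq_empty_or_nonempty with h | ⟨s, _⟩
  · simp [h]
  have hp0 : 0 ≤ p := (abs_nonneg _).trans (mark_diag A n s s p hp)
  have h2 := sq_sum_le_card_mul_sum_sq (s := f.support) (f := fun s => |f s|)
  simp only [sq_abs] at h2
  simp only [← sq (f _)]
  nlinarith [mul_le_mul_of_nonneg_left h2 hp0]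

lemma conv_quot (M : Subgroup (FreeGroup (Fin 2))) [M.Normal]
    (ν : FreeGroup (Fin 2) ⧸ M → ℝ) (x : FreeGroup (Fin 2) ⧸ M) :
    conv (lazySRWQuot 2 M) ν x = 1 / 2 * ν x +
      (1 / 8 * (ν ((FreeGroup.of 0 : FreeGroup (Fin 2))⁻¹ * x) +
        ν ((FreeGroup.of 0 : FreeGroup (Fin 2)) * x)) +
      1 / 8 * (ν ((FreeGroup.of 1 : FreeGroup (Fin 2))⁻¹ * x) +
        ν ((FreeGroup.of 1 : FreeGroup (Fin 2)) * x))) := by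
  classical
  let c : Fin 5 → ℝ := ![1 / 2, 1 / 8, 1 / 8, 1 / 8, 1 / 8]
  let g : Fin 5 → FreeGroup (Fin 2) :=
    ![1, FreeGroup.of 0, (FreeGroup.of 0)⁻¹, FreeGroup.of 1, (FreeGroup.of 1)⁻¹]
  have hinj : Function.Injective g := by
    decide
  have hmu : ∀ w, lazySRW 2 w = ∑ i, if w = g i then c i else 0 := by
    intro w
    by_cases hw : ∃ i, w = g i
    · obtain ⟨i, rfl⟩ := hw
      rw [Finset.sum_eq_single i]
      · rw [if_pos rfl]
        have hne : ∀ j : Fin 5, j ≠ 0 → g j ≠ 1 := fun j hj h => hj (hinj h)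
        unfold lazySRW
        by_cases h0 : i = 0
        · subst h0
          simp [g, c]
        · rw [if_neg (hne i h0), if_pos]
          · fin_cases i <;> simp [c] at h0 ⊢ <;> norm_num
          · fin_cases i
            · simp at h0
            · exact ⟨0, Or.inl rfl⟩
            · exact ⟨0, Or.inr rfl⟩
            · exact ⟨1, Or.inl rfl⟩
            · exact ⟨1, Or.inr rfl⟩
      · intro j _ hj
        rw [if_neg (fun h => hj (hinj h).symm)]
      · simp
    · rw [Finset.sum_eq_zero]
      · unfold lazySRW
        have h1 : ¬ w = 1 := fun h => hw ⟨0, h⟩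
        rw [if_neg h1, if_neg]
        rintro ⟨i, hi⟩
        apply hw
        fin_cases i
        · rcases hi with h | h
          · exact ⟨1, h⟩
          · exact ⟨2, h⟩
        · rcases hi with h | h
          · exact ⟨3, h⟩
          · exact ⟨4, h⟩
      · intro i _
        rw [if_neg (fun h => hw ⟨i, h⟩)]
  have hpush : ∀ h, lazySRWQuot 2 M h =
      ∑ i, if h = (QuotientGroup.mk (g i) : FreeGroup (Fin 2) ⧸ M) then c i else 0 := by
    intro h
    unfold lazySRWQuot pushforward
    simp only [hmu]
    rw [Summable.tsum_finsetSum]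
    · apply Finset.sum_congr rfl
      intro i _
      by_cases hi : h = (QuotientGroup.mk (g i) : FreeGroup (Fin 2) ⧸ M)
      · rw [if_pos hi, tsum_eq_single ⟨g i, hi.symm⟩]
        · simp
        · rintro ⟨w, hw⟩ hne
          rw [if_neg]
          intro h'
          exact hne (Subtype.ext h')
      · rw [if_neg hi]
        convert tsum_zero with w
        rw [if_neg]
        intro h'
        apply hi
        rw [← w.2, h']
    · intro i _
      apply summable_of_hasFiniteSupport
      apply Set.Finite.subset (s := {w | w.1 = g i})
      · exact Set.Finite.preimage Subtype.val_injective.injOn (Set.finite_singleton (g i))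
      · intro w hw
        by_contra hne
        exact hw (if_neg hne)
  unfold conv
  simp only [hpush, Finset.sum_mul]
  rw [Summable.tsum_finsetSum]
  · have : ∀ i, ∑' h : FreeGroup (Fin 2) ⧸ M,
        (if h = (QuotientGroup.mk (g i) : FreeGroup (Fin 2) ⧸ M) then c i else 0) * ν (h⁻¹ * x)
        = c i * ν ((QuotientGroup.mk (g i) : FreeGroup (Fin 2) ⧸ M)⁻¹ * x) := by
      intro i
      rw [tsum_eq_single (QuotientGroup.mk (g i) : FreeGroup (Fin 2) ⧸ M)]
      · simp
      · intro h hne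
        rw [if_neg hne, zero_mul]
    simp only [this]
    rw [Fin.sum_univ_five]
    simp [c, g]
    ring
  · intro i _
    apply summable_of_hasFiniteSupport
    apply Set.Finite.subset (Set.finite_singleton (QuotientGroup.mk (g i) : FreeGroup (Fin 2) ⧸ M))
    intro w hw
    by_contra hne
    have hne' : ¬ w = (QuotientGroup.mk (g i) : FreeGroup (Fin 2) ⧸ M) := hne
    exact hw (by simp only; rw [if_neg hne', zero_mul])

lemma mark_le_convPow {S : Type} (A : Fin 2 → Equiv.Perm S) (M : Subgroup (FreeGroup (Fin 2)))
    [M.Normal] (hA : StabIn A M) (s : S) (k : ℕ) (w : FreeGroup (Fin 2)) :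
    ((mark A)^[k] (Finsupp.single s 1)) (FreeGroup.lift A w s) ≤
      convPow (lazySRWQuot 2 M) k (QuotientGroup.mk w) := by
  classical
  induction k generalizing w with
  | zero =>
    simp only [Function.iterate_zero, id_eq, convPow]
    by_cases h : FreeGroup.lift A w s = s
    · rw [if_pos ((QuotientGroup.eq_one_iff w).2 (hA w s h)), h]; simp
    · rw [Finsupp.single_eq_of_ne h]
      split_ifs <;> norm_num
  | succ k ih =>
    rw [Function.iterate_succ_apply', mark_apply]
    change _ ≤ conv _ _ _
    rw [conv_quot]
    have h1 : ∀ i, (A i).symm (FreeGroup.lift A w s) =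
        FreeGroup.lift A ((FreeGroup.of i)⁻¹ * w) s := by
      intro i; rw [map_mul, map_inv, FreeGroup.lift_apply_of]; rfl
    have h2 : ∀ i, A i (FreeGroup.lift A w s) =
        FreeGroup.lift A (FreeGroup.of i * w) s := by
      intro i; rw [map_mul, FreeGroup.lift_apply_of]; rfl
    rw [h1, h1, h2, h2]
    have i1 := ih w
    have i2 := ih ((FreeGroup.of 0)⁻¹ * w)
    have i3 := ih (FreeGroup.of 0 * w)
    have i4 := ih ((FreeGroup.of 1)⁻¹ * w)
    have i5 := ih (FreeGroup.of 1 * w)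
    simp only [QuotientGroup.mk_mul, QuotientGroup.mk_inv] at i1 i2 i3 i4 i5
    simp only [QuotientGroup.mk_inv]
    linarith

lemma return_lower (M : Subgroup (FreeGroup (Fin 2))) [M.Normal] (ε : ℝ) (V : ℕ)
    (h : Fol M ε V) (hε : ε ≤ 1) (n : ℕ) :
    (1 - ε / 2) ^ (2 * n) ≤ V * convPow (lazySRWQuot 2 M) (2 * n) 1 := by
  classical
  obtain ⟨S, A, U, f, hst, hf0, hU, hf, hpos, hcor⟩ := h
  let F : S →₀ ℝ := Finsupp.onFinset U f (fun s hs => by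
    by_contra h; exact hs (hf s h))
  have hFs : F.support ⊆ U := Finsupp.support_onFinset_subset
  have hF : ∀ s, F s = f s := fun s => rfl
  have hn : ip F F = ∑ s ∈ U, f s ^ 2 := by
    rw [ip_eq _ _ U hFs]; simp only [hF, sq]
  have hpos' : 0 < ip F F := by rw [hn]; exact hpos
  have hc : ∀ i, (1 - ε) * ip F F ≤ ip F (F.equivMapDomain (A i).symm) := by
    intro i
    rw [hn, ip_eq _ _ U hFs]
    simp only [Finsupp.equivMapDomain_apply, Equiv.symm_symm, hF]
    exact hcor i
  have hR : (1 - ε / 2) * ip F F ≤ ip (mark A F) F := by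
    rw [mark_symm]
    simp only [mark, ip_add_right, ip_smul_right]
    have h1 : ∀ i, ip F (F.equivMapDomain (A i)) = ip F (F.equivMapDomain (A i).symm) := by
      intro i; rw [← ip_perm, ip_comm]
    rw [h1, h1]
    have := hc 0
    have := hc 1
    linarith
  have hg := mark_growth A F (1 - ε / 2) (by linarith) hpos' hR n
  have hp : ∀ s, ((mark A)^[2 * n] (Finsupp.single s 1)) s ≤
      convPow (lazySRWQuot 2 M) (2 * n) 1 := by
    intro s
    have := mark_le_convPow A M hst s (2 * n) 1
    simpa using this
  have hu := mark_upper A F n _ hp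
  have h3 := hg.trans hu
  rw [← mul_assoc] at h3
  have h4 := le_of_mul_le_mul_right h3 hpos'
  refine h4.trans ?_
  rw [mul_comm]
  have hs : ∃ s : S, True := by
    by_contra hno
    have : U = ∅ := by
      ext s; exact (hno ⟨s, trivial⟩).elim
    rw [this] at hpos
    simp at hpos
  obtain ⟨s, -⟩ := hs
  have hp0 : 0 ≤ convPow (lazySRWQuot 2 M) (2 * n) 1 :=
    (abs_nonneg _).trans (mark_diag A n s s _ hp)
  apply mul_le_mul_of_nonneg_right _ hp0
  exact_mod_cast (Finset.card_le_card hFs).trans hU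

/-! ### Iteration and asymptotics -/

/-- Support sizes along the iteration. -/
def vSeq (q r : ℕ) : ℕ → ℕ
  | 0 => r ^ 3 * q ^ r
  | k + 1 => vSeq q r k * (r ^ 2) ^ (2 * vSeq q r k)

lemma Fol_iter (q : ℕ) (hq : 2 ≤ q) (N : Subgroup (FreeGroup (Fin 2)))
    (hN : N = Subgroup.normalClosure
      {(FreeGroup.of 0)⁻¹ * FreeGroup.of 1 * FreeGroup.of 0 * (FreeGroup.of 1) ^ (-(q : ℤ))})
    [N.Normal] (r : ℕ) (hr : 2 ≤ r) (k : ℕ) :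
    Fol (iterComm N k) ((5 + k) / (r : ℝ) ^ 2) (vSeq q r k) := by
  induction k with
  | zero =>
    have := Fol_base q hq N hN r hr
    simpa [iterComm, vSeq] using this
  | succ k ih =>
    have := Fol_step (iterComm N k) _ (by positivity) _ (r ^ 2) (Nat.one_le_pow _ _ (by omega)) ih
    have e : ((5 + k) / (r : ℝ) ^ 2) + 1 / ((r ^ 2 : ℕ) : ℝ) =
        (5 + (k + 1 : ℕ)) / (r : ℝ) ^ 2 := by
      push_cast; ring
    rw [e] at this
    exact this

lemma vSeq_lower (q r : ℕ) (hq : 2 ≤ q) (hr : 2 ≤ r) (k : ℕ) : r ^ 2 + 3 ≤ vSeq q r k := by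
  induction k with
  | zero =>
    have h1 : 2 ^ 2 ≤ q ^ r := (Nat.pow_le_pow_left hq 2).trans
      (Nat.pow_le_pow_right (by omega) hr)
    have h2 : r ^ 2 ≤ r ^ 3 := Nat.pow_le_pow_right (by omega) (by omega)
    have h3 : 2 ^ 2 ≤ r ^ 2 := Nat.pow_le_pow_left hr 2
    change _ ≤ r ^ 3 * q ^ r
    nlinarith
  | succ k ih =>
    refine ih.trans ?_
    exact Nat.le_mul_of_pos_right _ (by positivity)

lemma vSeq_succ_le (q r : ℕ) (hq : 2 ≤ q) (hr : 2 ≤ r) (k : ℕ) :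
    (vSeq q r (k + 1) : ℝ) ≤ Real.exp ((vSeq q r k : ℝ) ^ 3) := by
  have h := vSeq_lower q r hq hr k
  set V := vSeq q r k with hV
  have h1 : vSeq q r (k + 1) ≤ V ^ (3 * V) := by
    change V * (r ^ 2) ^ (2 * V) ≤ _
    calc V * (r ^ 2) ^ (2 * V) ≤ V * V ^ (2 * V) :=
          Nat.mul_le_mul_left _ (Nat.pow_le_pow_left (by omega) _)
      _ = V ^ (2 * V + 1) := by ring
      _ ≤ V ^ (3 * V) := Nat.pow_le_pow_right (by omega) (by omega)
  have h2 : (vSeq q r (k + 1) : ℝ) ≤ (V : ℝ) ^ (3 * V) := by exact_mod_cast h1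
  refine h2.trans ?_
  have h3 : (V : ℝ) ≤ Real.exp V := by linarith [Real.add_one_le_exp (V : ℝ)]
  refine (pow_le_pow_left₀ (by positivity) h3 _).trans ?_
  rw [← Real.exp_nat_mul, Real.exp_le_exp]
  have h4 : (3 : ℝ) ≤ V := by
    have : 3 ≤ V := by omega
    exact_mod_cast this
  push_cast
  nlinarith [sq_nonneg (V : ℝ)]

lemma iterLog_nonneg (k : ℕ) (x : ℝ) (hx : 0 ≤ x) : 0 ≤ iterLog k x := by
  induction k with
  | zero => exact hx
  | succ k ih => exact Real.log_nonneg (by linarith)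

lemma iterLog_succ_le (k : ℕ) (x : ℝ) (hx : 0 ≤ x) : iterLog (k + 1) x ≤ iterLog k x := by
  have h := iterLog_nonneg k x hx
  change Real.log (1 + iterLog k x) ≤ _
  have := Real.log_le_sub_one_of_pos (x := 1 + iterLog k x) (by linarith)
  linarith

lemma iterLog_anti (x : ℝ) (hx : 0 ≤ x) : Antitone (fun k => iterLog k x) :=
  antitone_nat_of_succ_le fun k => iterLog_succ_le k x hx

lemma exp_iterLog (k : ℕ) (x : ℝ) (hx : 0 ≤ x) :
    Real.exp (iterLog (k + 1) x) = 1 + iterLog k x :=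
  Real.exp_log (by linarith [iterLog_nonneg k x hx])

lemma iterLog_tendsto (k : ℕ) :
    Filter.Tendsto (fun n : ℕ => iterLog k (n : ℝ)) Filter.atTop Filter.atTop := by
  induction k with
  | zero => exact tendsto_natCast_atTop_atTop
  | succ k ih =>
    exact Real.tendsto_log_atTop.comp (Filter.tendsto_atTop_add_const_left _ 1 ih)

lemma vSeq_upper (q r : ℕ) (hq : 2 ≤ q) (hr : 2 ≤ r) (K : ℕ) (x : ℝ) (hx : 0 ≤ x)
    (hbig : 38 ≤ iterLog (K + 1) x) (hrx : (18 + 6 * q : ℝ) * r ≤ iterLog (K + 1) x) (j : ℕ)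
    (hj : j ≤ K) : (vSeq q r j : ℝ) ^ 6 ≤ 1 + iterLog (K - j) x := by
  induction j with
  | zero =>
    rw [Nat.sub_zero, ← exp_iterLog K x hx]
    have h1 : (r : ℝ) ≤ Real.exp r := by linarith [Real.add_one_le_exp (r : ℝ)]
    have h2 : (q : ℝ) ≤ Real.exp q := by linarith [Real.add_one_le_exp (q : ℝ)]
    have h3 : (vSeq q r 0 : ℝ) ≤ Real.exp r ^ 3 * Real.exp q ^ r := by
      change ((r ^ 3 * q ^ r : ℕ) : ℝ) ≤ _
      push_cast
      gcongr
    refine (pow_le_pow_left₀ (by positivity) h3 6).trans ?_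
    rw [← Real.exp_nat_mul, ← Real.exp_nat_mul, ← Real.exp_add, ← Real.exp_nat_mul,
      Real.exp_le_exp]
    push_cast
    linarith
  | succ j ih =>
    have ih := ih (by omega)
    obtain ⟨d, hd⟩ : ∃ d, K - j = d + 1 := ⟨K - j - 1, by omega⟩
    have hd2 : K - (j + 1) = d := by omega
    rw [hd] at ih
    rw [hd2, ← exp_iterLog d x hx]
    have hy : 38 ≤ iterLog (d + 1) x :=
      hbig.trans (iterLog_anti x hx (show d + 1 ≤ K + 1 by omega))
    refine (pow_le_pow_left₀ (by positivity) (vSeq_succ_le q r hq hr j) 6).trans ?_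
    rw [← Real.exp_nat_mul, Real.exp_le_exp]
    set y := iterLog (d + 1) x
    set v := (vSeq q r j : ℝ)
    have hv : (v ^ 3) ^ 2 ≤ 1 + y := by rw [← pow_mul]; exact ih
    push_cast
    apply le_of_sq_le_sq _ (by linarith)
    nlinarith

lemma tail_bound (n : ℕ) (y v : ℝ) (hy0 : 0 < y) (hy : y ≤ Real.log (1 + n))
    (hbig : 96 ≤ Real.log (1 + n)) (hv0 : 0 ≤ v) (hv : v ^ 6 ≤ 1 + n) : v ^ 3 ≤ n / y ^ 2 := by
  set L := Real.log (1 + n) with hL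
  have hn : (0 : ℝ) ≤ n := Nat.cast_nonneg n
  have hexp : Real.exp L = 1 + n := Real.exp_log (by linarith)
  set t := Real.exp (L / 2) with ht
  have htt : t * t = 1 + n := by rw [ht, ← Real.exp_add, add_halves, hexp]
  have ht0 : 0 < t := Real.exp_pos _
  have hv3 : v ^ 3 ≤ t := by
    apply le_of_sq_le_sq _ ht0.le
    rw [← pow_mul, sq t, htt]; exact hv
  have h1 := Real.pow_div_factorial_le_exp (L / 2) (by linarith) 3
  rw [← ht] at h1
  have h2 : 2 * L ^ 2 ≤ t := by
    refine le_trans ?_ h1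
    simp [Nat.factorial]
    nlinarith [sq_nonneg L]
  have h3 : y ^ 2 ≤ L ^ 2 := pow_le_pow_left₀ hy0.le hy 2
  rw [le_div_iff₀ (by positivity)]
  have h4 : v ^ 3 * y ^ 2 ≤ t * (t / 2) :=
    mul_le_mul hv3 (by linarith) (by positivity) ht0.le
  have h5 : t * (t / 2) = (1 + n) / 2 := by rw [← htt]; ring
  have h6 : (1 : ℝ) ≤ n := by
    have : L ≤ n := by
      have := Real.log_le_sub_one_of_pos (x := 1 + (n : ℝ)) (by linarith)
      linarith
    linarith
  linarith

lemma main_bound (q : ℕ) (hq : 2 ≤ q) (N : Subgroup (FreeGroup (Fin 2)))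
    (hN : N = Subgroup.normalClosure
      {(FreeGroup.of 0)⁻¹ * FreeGroup.of 1 * FreeGroup.of 0 * (FreeGroup.of 1) ^ (-(q : ℤ))})
    [N.Normal] (K : ℕ) :
    ∃ C : ℝ, ∃ n₀ : ℕ, ∀ n : ℕ, n₀ ≤ n →
      Real.exp (-C * (n : ℝ) / (iterLog (K + 1) n) ^ 2)
        ≤ convPow (lazySRWQuot 2 (iterComm N (K + 1))) (2 * n) 1 := by
  set D : ℝ := 18 + 6 * q with hD
  have hD0 : 0 < D := by positivity
  obtain ⟨n₀, hn₀⟩ := Filter.eventually_atTop.1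
    ((iterLog_tendsto (K + 1)).eventually_ge_atTop (96 + (K + 10) * D))
  refine ⟨2 * ((6 + K) * (4 * D ^ 2)) + 1, n₀, fun n hn => ?_⟩
  have hX := hn₀ n hn
  have hn0 : (0 : ℝ) ≤ n := Nat.cast_nonneg n
  set X := iterLog (K + 1) (n : ℝ) with hXdef
  have hKD : 0 ≤ (K + 10 : ℝ) * D := by positivity
  have hX0 : 0 < X := by linarith
  set r : ℕ := ⌊X / D⌋₊ with hr
  have hrle : (r : ℝ) ≤ X / D := Nat.floor_le (by positivity)
  have hrlt : X / D < r + 1 := Nat.lt_floor_add_one _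
  have hXD : (K : ℝ) + 10 ≤ X / D := by rw [le_div_iff₀ hD0]; linarith
  have hr9 : (K : ℝ) + 9 ≤ r := by linarith
  have hr2' : (2 : ℝ) ≤ r := by
    have : (0 : ℝ) ≤ K := Nat.cast_nonneg K
    linarith
  have hr2 : 2 ≤ r := by exact_mod_cast hr2'
  have hrhalf : X / (2 * D) ≤ r := by
    have : X / (2 * D) = X / D / 2 := by field_simp
    rw [this]; linarith
  have hfol := Fol_iter q hq N hN r hr2 (K + 1)
  set ε : ℝ := (5 + (K + 1 : ℕ)) / (r : ℝ) ^ 2 with hε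
  have hr0 : (0 : ℝ) < r := by linarith
  have hε0 : 0 ≤ ε := by positivity
  have hε1 : ε ≤ 1 := by
    rw [hε, div_le_one (by positivity)]
    push_cast; nlinarith
  have hret := return_lower _ _ _ hfol hε1 n
  have hlow : Real.exp (-(2 * ε * n)) ≤ (1 - ε / 2) ^ (2 * n) := by
    have h1 : Real.exp (-ε) ≤ 1 - ε / 2 := by
      have h2 : 1 + ε ≤ Real.exp ε := by linarith [Real.add_one_le_exp ε]
      rw [Real.exp_neg, inv_le_iff_one_le_mul₀ (Real.exp_pos _)]
      nlinarith
    have : Real.exp (-(2 * ε * n)) = Real.exp (-ε) ^ (2 * n) := by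
      rw [← Real.exp_nat_mul]; push_cast; ring_nf
    rw [this]
    exact pow_le_pow_left₀ (Real.exp_pos _).le h1 _
  have hrx : (18 + 6 * q : ℝ) * r ≤ X := by
    rw [le_div_iff₀ hD0] at hrle
    rw [← hD]; linarith
  have hup := vSeq_upper q r hq hr2 K n hn0 (by linarith) hrx K le_rfl
  rw [Nat.sub_self] at hup
  have hX1 : X ≤ Real.log (1 + n) := iterLog_anti (n : ℝ) hn0 (show 1 ≤ K + 1 by omega)
  have htail := tail_bound n X (vSeq q r K) hX0 hX1 (by linarith) (Nat.cast_nonneg _) hup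
  have hV : (vSeq q r (K + 1) : ℝ) ≤ Real.exp (n / X ^ 2) :=
    (vSeq_succ_le q r hq hr2 K).trans (Real.exp_le_exp.2 htail)
  have hVpos : (0 : ℝ) < vSeq q r (K + 1) := by
    have := vSeq_lower q r hq hr2 (K + 1)
    exact_mod_cast (by omega : 0 < vSeq q r (K + 1))
  have hεX : ε ≤ (6 + K) * (4 * D ^ 2) / X ^ 2 := by
    have h1 : (X / (2 * D)) ^ 2 ≤ (r : ℝ) ^ 2 := pow_le_pow_left₀ (by positivity) hrhalf 2
    calc ε ≤ (5 + (K + 1 : ℕ)) / (X / (2 * D)) ^ 2 := by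
          rw [hε]; gcongr
      _ = (6 + K) * (4 * D ^ 2) / X ^ 2 := by
          push_cast; field_simp; ring
  refine le_of_mul_le_mul_left ?_ hVpos
  refine le_trans ?_ (hlow.trans hret)
  refine (mul_le_mul_of_nonneg_right hV (Real.exp_pos _).le).trans ?_
  rw [← Real.exp_add, Real.exp_le_exp]
  have h7 : 2 * ε * n ≤ 2 * ((6 + K) * (4 * D ^ 2) / X ^ 2) * n := by gcongr
  have h8 : n / X ^ 2 + -(2 * ((6 + K) * (4 * D ^ 2)) + 1) * n / X ^ 2 =
    -(2 * ((6 + K) * (4 * D ^ 2) / X ^ 2) * n) := by ring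
  rw [h8]
  linarith

/-- Corollary: for `Γ_ℓ(N) = F_2/N^{(ℓ)}` with `F_2/N = BS(1,q)`, `q ≥ 2`, `ℓ ≥ 2`, the lazy
simple random walk satisfies `μ_ℓ^{(2n)}(e) ≥ exp(− C n/(log_{[ℓ-1]} n)²)` for large `n`. -/
theorem return_probability_lower_iterated_BS (q : ℕ) (hq : 2 ≤ q)
    (N : Subgroup (FreeGroup (Fin 2)))
    (hN : N = Subgroup.normalClosure
      {(FreeGroup.of 0)⁻¹ * FreeGroup.of 1 * FreeGroup.of 0 * (FreeGroup.of 1) ^ (-(q : ℤ))})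
    [N.Normal]
    (ℓ : ℕ) (hℓ : 2 ≤ ℓ) :
    ∃ C : ℝ, ∃ n₀ : ℕ, ∀ n : ℕ, n₀ ≤ n →
      Real.exp (-C * (n : ℝ) / (iterLog (ℓ - 1) n) ^ 2)
        ≤ convPow (lazySRWQuot 2 (iterComm N (ℓ - 1))) (2 * n) 1 := by
  obtain ⟨K, rfl⟩ : ∃ K, ℓ = K + 2 := ⟨ℓ - 2, by omega⟩
  exact main_bound q hq N hN K

end
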